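/- The Lax–Oleinik operators form a semigroup: for all τ₁, τ₂ ≥ 0 and every ψ : ℝ^d → ℝ ∪ {±∞}, one has S^{τ₁+τ₂}[ψ](x) = S^{τ₁}[S^{τ₂}[ψ]](x) for every x ∈ ℝ^d. -/

import Mathlib

open MeasureTheory Set

noncomputable section

/-- An admissible pair `(y,u)` on the time interval `[0,τ]`: the control `u` is measurable
with values in `U`, the trajectory `y` stays in `X`, and `y` is absolutely continuous with
`y'(s) = f (y s) (u s)` for a.e. `s ∈ [0,τ]` (expressed by the integral representation). -/
def IsAdmissible {d m : ℕ} (X : Set (EuclideanSpace ℝ (Fin d)))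
    (U : Set (EuclideanSpace ℝ (Fin m)))
    (f : EuclideanSpace ℝ (Fin d) → EuclideanSpace ℝ (Fin m) → EuclideanSpace ℝ (Fin d))
    (τ : ℝ) (y : ℝ → EuclideanSpace ℝ (Fin d))
    (u : ℝ → EuclideanSpace ℝ (Fin m)) : Prop :=
  Measurable u ∧ (∀ s ∈ Icc 0 τ, u s ∈ U) ∧ (∀ s ∈ Icc 0 τ, y s ∈ X) ∧
    ∀ t ∈ Icc 0 τ, y t = y 0 + ∫ s in (0:ℝ)..t, f (y s) (u s)

/-- The Lax–Oleinik operator: `S^τ[ψ](x)` is the supremum, in the extended reals, over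
admissible pairs `(y,u)` on `[0,τ]` with `y 0 = x`, of
`∫₀^τ ℓ(y(s),u(s)) ds + ψ(y(τ))`. -/
def laxOleinik {d m : ℕ} (X : Set (EuclideanSpace ℝ (Fin d)))
    (U : Set (EuclideanSpace ℝ (Fin m)))
    (f : EuclideanSpace ℝ (Fin d) → EuclideanSpace ℝ (Fin m) → EuclideanSpace ℝ (Fin d))
    (ℓ : EuclideanSpace ℝ (Fin d) → EuclideanSpace ℝ (Fin m) → ℝ)
    (τ : ℝ) (ψ : EuclideanSpace ℝ (Fin d) → EReal)
    (x : EuclideanSpace ℝ (Fin d)) : EReal :=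
  ⨆ (p : (ℝ → EuclideanSpace ℝ (Fin d)) × (ℝ → EuclideanSpace ℝ (Fin m)))
    (_ : IsAdmissible X U f τ p.1 p.2 ∧ p.1 0 = x),
      ((((∫ s in (0:ℝ)..τ, ℓ (p.1 s) (p.2 s)) : ℝ) : EReal) + ψ (p.1 τ))

theorem measurable_indicator_primitive {E : Type*} [NormedAddCommGroup E] [NormedSpace ℝ E]
    [MeasurableSpace E] [BorelSpace E] (F : ℝ → E) :
    Measurable ((Ici (0 : ℝ)).indicator fun t => ∫ s in (0:ℝ)..t, F s) := by
  classical
  set A : Set ℝ := {t | 0 ≤ t ∧ IntervalIntegrable F volume 0 t}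
  have hA : A.OrdConnected := by
    refine ⟨fun a ha b hb t ht => ⟨ha.1.trans ht.1, hb.2.mono_set ?_⟩⟩
    rw [uIcc_of_le (ha.1.trans ht.1), uIcc_of_le hb.1]
    exact Icc_subset_Icc_right ht.2
  have hcont : ContinuousOn (fun t => ∫ s in (0:ℝ)..t, F s) A := by
    intro t ht
    have hprim : ∀ b ∈ A, ContinuousWithinAt (fun t => ∫ s in (0:ℝ)..t, F s) (Icc 0 b) t := by
      intro b hb
      apply intervalIntegral.continuousWithinAt_primitive (by simp)
      simpa [hb.1] using hb.2
    by_cases h : ∃ b ∈ A, t < b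
    · obtain ⟨b, hb, htb⟩ := h
      refine (hprim b hb).mono_of_mem_nhdsWithin ?_
      filter_upwards [self_mem_nhdsWithin, mem_nhdsWithin_of_mem_nhds (Iio_mem_nhds htb)]
        with s hs hsb
      exact ⟨hs.1, le_of_lt hsb⟩
    · push Not at h
      exact (hprim t ht).mono fun s hs => ⟨hs.1, h s hs⟩
  have hpw := hcont.measurable_piecewise (g := fun _ => (0 : E)) continuousOn_const
    hA.measurableSet
  convert hpw using 1
  ext t
  by_cases h0 : 0 ≤ t
  · by_cases hi : IntervalIntegrable F volume 0 t
    · simp [Set.piecewise, A, h0, hi]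
    · simp [Set.piecewise, A, h0, hi, intervalIntegral.integral_undef hi]
  · simp [Set.piecewise, A, h0]

section Admissible

variable {d m : ℕ} {X : Set (EuclideanSpace ℝ (Fin d))} {U : Set (EuclideanSpace ℝ (Fin m))}
  {f : EuclideanSpace ℝ (Fin d) → EuclideanSpace ℝ (Fin m) → EuclideanSpace ℝ (Fin d)}
  {τ τ₁ τ₂ : ℝ} {y z : ℝ → EuclideanSpace ℝ (Fin d)} {u v : ℝ → EuclideanSpace ℝ (Fin m)}

/-- No integrability of `s ↦ f (y s) (u s)` is needed: the integral representation alone makes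
an admissible trajectory measurable. -/
theorem IsAdmissible.aemeasurable (h : IsAdmissible X U f τ y u) :
    AEMeasurable y (volume.restrict (Icc 0 τ)) := by
  refine ⟨fun t => y 0 + (Ici (0 : ℝ)).indicator (fun t => ∫ s in (0:ℝ)..t, f (y s) (u s)) t,
    (measurable_indicator_primitive _).const_add _, ?_⟩
  filter_upwards [ae_restrict_mem measurableSet_Icc] with t ht
  rw [indicator_of_mem (mem_Ici.2 ht.1)]
  exact h.2.2.2 t ht

theorem IsAdmissible.intervalIntegrable {E : Type*} [NormedAddCommGroup E]
    {g : EuclideanSpace ℝ (Fin d) → EuclideanSpace ℝ (Fin m) → E}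
    (h : IsAdmissible X U f τ y u)
    (hg : Continuous fun p : EuclideanSpace ℝ (Fin d) × EuclideanSpace ℝ (Fin m) => g p.1 p.2)
    (hb : ∃ C, ∀ x u, ‖g x u‖ ≤ C) {a b : ℝ} (ha : a ∈ Icc 0 τ) (hb' : b ∈ Icc 0 τ) :
    IntervalIntegrable (fun s => g (y s) (u s)) volume a b := by
  obtain ⟨C, hC⟩ := hb
  have hm : AEStronglyMeasurable (fun s => g (y s) (u s)) (volume.restrict (Icc 0 τ)) :=
    hg.comp_aestronglyMeasurable
      (h.aemeasurable.prodMk h.1.aemeasurable).aestronglyMeasurable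
  have hi : IntegrableOn (fun s => g (y s) (u s)) (Icc 0 τ) :=
    Integrable.of_bound hm C (Filter.Eventually.of_forall fun s => hC _ _)
  exact (hi.mono_set (uIcc_subset_Icc ha hb')).intervalIntegrable

theorem intervalIntegral_congr_pair {E : Type*} [NormedAddCommGroup E] [NormedSpace ℝ E]
    (g : EuclideanSpace ℝ (Fin d) → EuclideanSpace ℝ (Fin m) → E)
    (hy : EqOn z y (Icc 0 τ)) (hu : EqOn v u (Ioc 0 τ)) {t : ℝ} (ht : t ∈ Icc 0 τ) :
    ∫ s in (0:ℝ)..t, g (z s) (v s) = ∫ s in (0:ℝ)..t, g (y s) (u s) := by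
  refine intervalIntegral.integral_congr_ae (Filter.Eventually.of_forall fun s hs => ?_)
  rw [uIoc_of_le ht.1] at hs
  rw [hy ⟨hs.1.le, hs.2.trans ht.2⟩, hu ⟨hs.1, hs.2.trans ht.2⟩]

theorem IsAdmissible.congr (h : IsAdmissible X U f τ y u) (hv : Measurable v) (hv0 : v 0 ∈ U)
    (hy : EqOn z y (Icc 0 τ)) (hu : EqOn v u (Ioc 0 τ)) : IsAdmissible X U f τ z v := by
  obtain ⟨-, hU, hX, hint⟩ := h
  refine ⟨hv, fun s hs => ?_, fun s hs => hy hs ▸ hX s hs, fun t ht => ?_⟩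
  · rcases hs.1.eq_or_lt with rfl | h0
    · exact hv0
    · rw [hu ⟨h0, hs.2⟩]
      exact hU s hs
  · rw [hy ht, hy ⟨le_rfl, ht.1.trans ht.2⟩, intervalIntegral_congr_pair f hy hu ht]
    exact hint t ht

theorem IsAdmissible.mono (h : IsAdmissible X U f τ y u) (hτ : τ₁ ≤ τ) :
    IsAdmissible X U f τ₁ y u :=
  have hs : Icc 0 τ₁ ⊆ Icc 0 τ := Icc_subset_Icc_right hτ
  ⟨h.1, fun s hs' => h.2.1 s (hs hs'), fun s hs' => h.2.2.1 s (hs hs'),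
    fun t ht => h.2.2.2 t (hs ht)⟩

theorem IsAdmissible.shift (h : IsAdmissible X U f (τ₁ + τ₂) y u)
    (hfc : Continuous fun p : EuclideanSpace ℝ (Fin d) × EuclideanSpace ℝ (Fin m) => f p.1 p.2)
    (hfb : ∃ C, ∀ x u, ‖f x u‖ ≤ C) (hτ₁ : 0 ≤ τ₁) :
    IsAdmissible X U f τ₂ (fun s => y (τ₁ + s)) (fun s => u (τ₁ + s)) := by
  have hmem : ∀ s ∈ Icc 0 τ₂, τ₁ + s ∈ Icc 0 (τ₁ + τ₂) := fun s hs =>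
    ⟨add_nonneg hτ₁ hs.1, by linarith [hs.2]⟩
  refine ⟨h.1.comp (measurable_const_add τ₁), fun s hs => h.2.1 _ (hmem s hs),
    fun s hs => h.2.2.1 _ (hmem s hs), fun t ht => ?_⟩
  have h0 : (0 : ℝ) ∈ Icc 0 τ₂ := ⟨le_rfl, ht.1.trans ht.2⟩
  have hz : (0 : ℝ) ∈ Icc 0 (τ₁ + τ₂) := ⟨le_rfl, (hmem 0 h0).1.trans (hmem 0 h0).2⟩
  have h1 := hmem 0 h0
  rw [add_zero] at h1
  dsimp only
  rw [intervalIntegral.integral_comp_add_left (fun s => f (y s) (u s)), add_zero,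
    h.2.2.2 _ (hmem t ht), h.2.2.2 _ h1, add_assoc,
    intervalIntegral.integral_add_adjacent_intervals (h.intervalIntegrable hfc hfb hz h1)
      (h.intervalIntegrable hfc hfb h1 (hmem t ht))]

theorem IsAdmissible.of_mono_of_shift (h₁ : IsAdmissible X U f τ₁ y u)
    (h₂ : IsAdmissible X U f τ₂ (fun s => y (τ₁ + s)) (fun s => u (τ₁ + s)))
    (hfc : Continuous fun p : EuclideanSpace ℝ (Fin d) × EuclideanSpace ℝ (Fin m) => f p.1 p.2)
    (hfb : ∃ C, ∀ x u, ‖f x u‖ ≤ C) (hτ₁ : 0 ≤ τ₁) :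
    IsAdmissible X U f (τ₁ + τ₂) y u := by
  have hmem : ∀ s ∈ Icc 0 (τ₁ + τ₂), τ₁ ≤ s → s - τ₁ ∈ Icc 0 τ₂ := fun s hs hs' =>
    ⟨sub_nonneg.2 hs', by linarith [hs.2]⟩
  refine ⟨h₁.1, fun s hs => ?_, fun s hs => ?_, fun t ht => ?_⟩
  · rcases le_total s τ₁ with hs' | hs'
    · exact h₁.2.1 s ⟨hs.1, hs'⟩
    · simpa using h₂.2.1 _ (hmem s hs hs')
  · rcases le_total s τ₁ with hs' | hs'
    · exact h₁.2.2.1 s ⟨hs.1, hs'⟩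
    · simpa using h₂.2.2.1 _ (hmem s hs hs')
  · rcases le_total t τ₁ with ht' | ht'
    · exact h₁.2.2.2 t ⟨ht.1, ht'⟩
    · have hm := hmem t ht ht'
      have e₂ := h₂.2.2.2 _ hm
      have i₂ := h₂.intervalIntegrable hfc hfb ⟨le_rfl, hm.1.trans hm.2⟩ hm
      have i₁ := h₁.intervalIntegrable hfc hfb ⟨le_rfl, hτ₁⟩ ⟨hτ₁, le_rfl⟩
      have i₃ : IntervalIntegrable (fun s => f (y s) (u s)) volume τ₁ t := by
        simpa using i₂.comp_sub_right τ₁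
      rw [intervalIntegral.integral_comp_add_left (fun s => f (y s) (u s))] at e₂
      simp only [add_zero, add_sub_cancel] at e₂
      rw [e₂, h₁.2.2.2 τ₁ ⟨hτ₁, le_rfl⟩, add_assoc,
        intervalIntegral.integral_add_adjacent_intervals i₁ i₃]

theorem IsAdmissible.integral_add
    {ℓ : EuclideanSpace ℝ (Fin d) → EuclideanSpace ℝ (Fin m) → ℝ}
    (h : IsAdmissible X U f (τ₁ + τ₂) y u)
    (hℓc : Continuous fun p : EuclideanSpace ℝ (Fin d) × EuclideanSpace ℝ (Fin m) => ℓ p.1 p.2)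
    (hℓb : ∃ C, ∀ x u, ‖ℓ x u‖ ≤ C) (hτ₁ : 0 ≤ τ₁) (hτ₂ : 0 ≤ τ₂) :
    ∫ s in (0:ℝ)..(τ₁ + τ₂), ℓ (y s) (u s) =
      (∫ s in (0:ℝ)..τ₁, ℓ (y s) (u s)) +
        ∫ s in (0:ℝ)..τ₂, ℓ (y (τ₁ + s)) (u (τ₁ + s)) := by
  have hz : (0 : ℝ) ∈ Icc 0 (τ₁ + τ₂) := ⟨le_rfl, by linarith⟩
  have h₁ : τ₁ ∈ Icc 0 (τ₁ + τ₂) := ⟨hτ₁, by linarith⟩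
  have h₂ : τ₁ + τ₂ ∈ Icc 0 (τ₁ + τ₂) := ⟨by linarith, le_rfl⟩
  rw [intervalIntegral.integral_comp_add_left (fun s => ℓ (y s) (u s)), add_zero,
    intervalIntegral.integral_add_adjacent_intervals (h.intervalIntegrable hℓc hℓb hz h₁)
      (h.intervalIntegrable hℓc hℓb h₁ h₂)]

/-- Two admissible pairs with matching endpoints concatenate. -/
theorem IsAdmissible.exists_concat (h₁ : IsAdmissible X U f τ₁ y u)
    (h₂ : IsAdmissible X U f τ₂ z v) (hyz : z 0 = y τ₁)
    (hfc : Continuous fun p : EuclideanSpace ℝ (Fin d) × EuclideanSpace ℝ (Fin m) => f p.1 p.2)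
    (hfb : ∃ C, ∀ x u, ‖f x u‖ ≤ C) (hτ₁ : 0 ≤ τ₁) :
    ∃ w c, IsAdmissible X U f (τ₁ + τ₂) w c ∧ EqOn w y (Icc 0 τ₁) ∧ EqOn c u (Icc 0 τ₁) ∧
      EqOn (fun s => w (τ₁ + s)) z (Icc 0 τ₂) ∧ EqOn (fun s => c (τ₁ + s)) v (Ioc 0 τ₂) := by
  classical
  let w : ℝ → EuclideanSpace ℝ (Fin d) := fun s => if s ≤ τ₁ then y s else z (s - τ₁)
  let c : ℝ → EuclideanSpace ℝ (Fin m) := fun s => if s ≤ τ₁ then u s else v (s - τ₁)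
  have hc : Measurable c :=
    Measurable.ite measurableSet_Iic h₁.1 (h₂.1.comp (measurable_sub_const τ₁))
  have hwy : EqOn w y (Icc 0 τ₁) := fun s hs => if_pos hs.2
  have hcu : EqOn c u (Icc 0 τ₁) := fun s hs => if_pos hs.2
  have hwz : EqOn (fun s => w (τ₁ + s)) z (Icc 0 τ₂) := fun s hs => by
    rcases hs.1.eq_or_lt with rfl | h0
    · simp [w, hyz]
    · simp [w, h0.not_ge]
  have hcv : EqOn (fun s => c (τ₁ + s)) v (Ioc 0 τ₂) := fun s hs => by
    simp [c, hs.1.not_ge]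
  have hcU : ∀ s ∈ Icc 0 τ₁, c s ∈ U := fun s hs => hcu hs ▸ h₁.2.1 s hs
  refine ⟨w, c, IsAdmissible.of_mono_of_shift ?_ ?_ hfc hfb hτ₁, hwy, hcu, hwz, hcv⟩
  · exact h₁.congr hc (hcU 0 ⟨le_rfl, hτ₁⟩) hwy (hcu.mono Ioc_subset_Icc_self)
  · exact h₂.congr (hc.comp (measurable_const_add τ₁))
      (by simpa using hcU τ₁ ⟨hτ₁, le_rfl⟩) hwz hcv

theorem le_laxOleinik {ℓ : EuclideanSpace ℝ (Fin d) → EuclideanSpace ℝ (Fin m) → ℝ}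
    (ψ : EuclideanSpace ℝ (Fin d) → EReal) (h : IsAdmissible X U f τ y u) :
    (((∫ s in (0:ℝ)..τ, ℓ (y s) (u s)) : ℝ) : EReal) + ψ (y τ) ≤
      laxOleinik X U f ℓ τ ψ (y 0) :=
  le_iSup₂_of_le (y, u) ⟨h, rfl⟩ le_rfl

end Admissible

/-- The semigroup property of the Lax–Oleinik operators:
`S^{τ₁+τ₂}[ψ] = S^{τ₁}[S^{τ₂}[ψ]]` pointwise. -/
theorem laxOleinik_semigroup {d m : ℕ}
    (X : Set (EuclideanSpace ℝ (Fin d))) (hX : Bornology.IsBounded X)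
    (U : Set (EuclideanSpace ℝ (Fin m)))
    (ℓ : EuclideanSpace ℝ (Fin d) → EuclideanSpace ℝ (Fin m) → ℝ)
    (hℓc : Continuous fun p : EuclideanSpace ℝ (Fin d) × EuclideanSpace ℝ (Fin m) => ℓ p.1 p.2)
    (hℓb : ∃ C, ∀ x u, |ℓ x u| ≤ C)
    (f : EuclideanSpace ℝ (Fin d) → EuclideanSpace ℝ (Fin m) → EuclideanSpace ℝ (Fin d))
    (hfc : Continuous fun p : EuclideanSpace ℝ (Fin d) × EuclideanSpace ℝ (Fin m) => f p.1 p.2)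
    (hfb : ∃ C, ∀ x u, ‖f x u‖ ≤ C)
    (τ₁ τ₂ : ℝ) (hτ₁ : 0 ≤ τ₁) (hτ₂ : 0 ≤ τ₂)
    (ψ : EuclideanSpace ℝ (Fin d) → EReal)
    (x : EuclideanSpace ℝ (Fin d)) :
    laxOleinik X U f ℓ (τ₁ + τ₂) ψ x =
      laxOleinik X U f ℓ τ₁ (laxOleinik X U f ℓ τ₂ ψ) x := by
  apply le_antisymm
  · refine iSup₂_le ?_
    rintro ⟨y, u⟩ ⟨h, rfl⟩
    have h₂ := le_laxOleinik (ℓ := ℓ) ψ (h.shift hfc hfb hτ₁)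
    rw [add_zero] at h₂
    simp only [h.integral_add hℓc hℓb hτ₁ hτ₂, EReal.coe_add, add_assoc]
    exact (add_le_add_right h₂ _).trans
      (le_laxOleinik _ (h.mono (le_add_of_nonneg_right hτ₂)))
  · refine iSup₂_le ?_
    rintro ⟨y, u⟩ ⟨h₁, rfl⟩
    rw [add_comm]
    refine EReal.add_le_of_le_sub (iSup₂_le ?_)
    rintro ⟨z, v⟩ ⟨h₂, hz⟩
    refine EReal.le_sub_iff_add_le (by simp) (by simp) |>.2 ?_
    obtain ⟨w, c, h, hwy, hcu, hwz, hcv⟩ := h₁.exists_concat h₂ hz hfc hfb hτ₁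
    have hle := le_laxOleinik (ℓ := ℓ) ψ h
    rwa [h.integral_add hℓc hℓb hτ₁ hτ₂,
      intervalIntegral_congr_pair ℓ hwy (hcu.mono Ioc_subset_Icc_self) ⟨hτ₁, le_rfl⟩,
      intervalIntegral_congr_pair ℓ hwz hcv ⟨hτ₂, le_rfl⟩, hwy ⟨le_rfl, hτ₁⟩,
      show w (τ₁ + τ₂) = z τ₂ from hwz ⟨hτ₂, le_rfl⟩, EReal.coe_add, add_assoc, add_comm] at hle
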